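/- Let each f_t : ℝ^d → ℝ, t = 1, …, T, be convex and differentiable with ‖∇f_t(w)‖ ≤ G for all w ∈ 𝒟, let w_1 ∈ 𝒟, and define iterates of online gradient descent by w_{t+1} = Π(w_t − η·∇f_t(w_t)) with constant step size η > 0. Then the regret satisfies R = Σ_{t=1}^T f_t(w_t) − min_{w ∈ 𝒟} Σ_{t=1}^T f_t(w) ≤ D²/(2η) + η·G²·T/2. -/

import Mathlib

open scoped InnerProductSpace BigOperators

/-- Euclidean projection onto the ball `{w : ‖w‖ ≤ D/2}` in `ℝ^d`. -/
noncomputable def ballProj (d : ℕ) (D : ℝ) (p : EuclideanSpace ℝ (Fin d)) :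
    EuclideanSpace ℝ (Fin d) :=
  if ‖p‖ ≤ D / 2 then p else (D / (2 * ‖p‖)) • p

theorem norm_ballProj_le {d : ℕ} {D : ℝ} (hD : 0 ≤ D) (p : EuclideanSpace ℝ (Fin d)) :
    ‖ballProj d D p‖ ≤ D / 2 := by
  unfold ballProj
  split_ifs with h
  · exact h
  · have hp : 0 < ‖p‖ := by linarith
    rw [norm_smul, Real.norm_of_nonneg (by positivity)]
    apply le_of_eq
    field_simp

theorem norm_ballProj_sub_sq_le {d : ℕ} {D : ℝ} (hD : 0 ≤ D) (p v : EuclideanSpace ℝ (Fin d))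
    (hv : ‖v‖ ≤ D / 2) : ‖ballProj d D p - v‖ ^ 2 ≤ ‖p - v‖ ^ 2 := by
  unfold ballProj
  split_ifs with h
  · exact le_rfl
  · have hp : 0 < ‖p‖ := by linarith
    set s := D / (2 * ‖p‖) with hs
    have hsp : s * ‖p‖ = D / 2 := by rw [hs]; field_simp
    have hs0 : 0 ≤ s := by positivity
    have hs1 : s ≤ 1 := by rw [hs, div_le_one (by positivity)]; linarith
    have hin : ⟪p, v⟫_ℝ ≤ ‖p‖ * (s * ‖p‖) :=
      (real_inner_le_norm p v).trans (by rw [hsp]; gcongr)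
    rw [norm_sub_sq_real, norm_sub_sq_real, real_inner_smul_left, norm_smul,
      Real.norm_of_nonneg hs0]
    nlinarith [mul_nonneg (sub_nonneg.2 hs1) (sub_nonneg.2 hin), sq_nonneg ((1 - s) * ‖p‖)]

theorem ConvexOn.sub_le_inner_gradient {E : Type*} [NormedAddCommGroup E] [InnerProductSpace ℝ E]
    [CompleteSpace E] {f : E → ℝ} (hf : ConvexOn ℝ Set.univ f) {x : E}
    (hd : DifferentiableAt ℝ f x) (y : E) : f x - f y ≤ ⟪gradient f x, x - y⟫_ℝ := by
  have hline : ConvexOn ℝ Set.univ (f ∘ AffineMap.lineMap (k := ℝ) x y) :=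
    hf.comp_affineMap (AffineMap.lineMap x y)
  have hderiv : HasDerivAt (f ∘ AffineMap.lineMap (k := ℝ) x y) ⟪gradient f x, y - x⟫_ℝ 0 := by
    have hg : HasFDerivAt f (InnerProductSpace.toDual ℝ E (gradient f x))
        (AffineMap.lineMap (k := ℝ) x y 0) := by
      simpa using hd.hasGradientAt.hasFDerivAt
    simpa using hg.comp_hasDerivAt (0 : ℝ) AffineMap.hasDerivAt_lineMap
  have h := hline.le_slope_of_hasDerivAt (Set.mem_univ 0) (Set.mem_univ 1) zero_lt_one hderiv
  simp only [slope_def_field, Function.comp_apply, AffineMap.lineMap_apply_one,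
    AffineMap.lineMap_apply_zero, sub_zero, div_one] at h
  rw [← neg_sub y x, inner_neg_right]
  linarith

/-- The gradient step without projection: the regret of one round against `v`. -/
theorem ConvexOn.sub_le_of_gradient_step {E : Type*} [NormedAddCommGroup E]
    [InnerProductSpace ℝ E] [CompleteSpace E] {f : E → ℝ} (hf : ConvexOn ℝ Set.univ f) {x : E}
    (hd : DifferentiableAt ℝ f x) {G η : ℝ} (hη : 0 < η) (hG : ‖gradient f x‖ ≤ G) (v : E) :
    f x - f v ≤ (‖x - v‖ ^ 2 - ‖x - η • gradient f x - v‖ ^ 2) / (2 * η) + η * G ^ 2 / 2 := by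
  refine (hf.sub_le_inner_gradient hd v).trans ?_
  have hsq : ‖gradient f x‖ ^ 2 ≤ G ^ 2 := by gcongr
  have hexp : ‖x - η • gradient f x - v‖ ^ 2 =
      ‖x - v‖ ^ 2 - 2 * η * ⟪gradient f x, x - v⟫_ℝ + η ^ 2 * ‖gradient f x‖ ^ 2 := by
    rw [sub_right_comm, norm_sub_sq_real, real_inner_smul_right, norm_smul,
      Real.norm_of_nonneg hη.le, real_inner_comm]
    ring
  have hdiv : (‖x - v‖ ^ 2 - ‖x - η • gradient f x - v‖ ^ 2) / (2 * η) =
      ⟪gradient f x, x - v⟫_ℝ - η * ‖gradient f x‖ ^ 2 / 2 := by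
    rw [hexp]
    field_simp
    ring
  rw [hdiv]
  nlinarith

/-- For convex differentiable losses with gradients bounded by `G` on the ball
`𝒟` of radius `D/2`, online gradient descent `w (t+1) = Π(w t − η • ∇f_t(w t))` with constant
step size `η > 0` started at `w 1 ∈ 𝒟` has regret at most `D²/(2η) + η·G²·T/2`. -/
theorem stmt7 (d T : ℕ) (hT : 1 ≤ T) (D G η : ℝ) (hD : 0 < D) (hη : 0 < η)
    (f : ℕ → EuclideanSpace ℝ (Fin d) → ℝ)
    (hconv : ∀ t ∈ Finset.Icc 1 T, ConvexOn ℝ Set.univ (f t))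
    (hdiff : ∀ t ∈ Finset.Icc 1 T, Differentiable ℝ (f t))
    (hgrad : ∀ t ∈ Finset.Icc 1 T,
      ∀ v ∈ Metric.closedBall (0 : EuclideanSpace ℝ (Fin d)) (D / 2), ‖gradient (f t) v‖ ≤ G)
    (w : ℕ → EuclideanSpace ℝ (Fin d))
    (hw1 : w 1 ∈ Metric.closedBall (0 : EuclideanSpace ℝ (Fin d)) (D / 2))
    (hupd : ∀ t ∈ Finset.Icc 1 (T - 1), w (t + 1) = ballProj d D (w t - η • gradient (f t) (w t))) :
    (∑ t ∈ Finset.Icc 1 T, f t (w t)) -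
        (⨅ v : Metric.closedBall (0 : EuclideanSpace ℝ (Fin d)) (D / 2),
          ∑ t ∈ Finset.Icc 1 T, f t (v : EuclideanSpace ℝ (Fin d))) ≤
      D ^ 2 / (2 * η) + η * G ^ 2 * T / 2 := by
  have hstep (t : ℕ) (ht : t ∈ Finset.Icc 1 T) (hwt : ‖w t‖ ≤ D / 2)
      (v : EuclideanSpace ℝ (Fin d)) := (hconv t ht).sub_le_of_gradient_step
    (hdiff t ht (w t)) hη (hgrad t ht (w t) (mem_closedBall_zero_iff.2 hwt)) v
  have hball : ∀ n < T, ‖w (n + 1)‖ ≤ D / 2 := by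
    rintro (_ | n) hn
    · exact mem_closedBall_zero_iff.1 hw1
    · rw [hupd (n + 1) (Finset.mem_Icc.2 (by omega))]
      exact norm_ballProj_le hD.le _
  obtain ⟨N, rfl⟩ : ∃ N, T = N + 1 := ⟨T - 1, by omega⟩
  have : Nonempty (Metric.closedBall (0 : EuclideanSpace ℝ (Fin d)) (D / 2)) := ⟨⟨w 1, hw1⟩⟩
  rw [sub_le_comm]
  refine le_ciInf fun ⟨v, hv⟩ => ?_
  rw [mem_closedBall_zero_iff] at hv
  have hpartial : ∀ n < N + 1, ∑ t ∈ Finset.Icc 1 n, (f t (w t) - f t v) ≤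
      (D ^ 2 - ‖w (n + 1) - v‖ ^ 2) / (2 * η) + η * G ^ 2 * n / 2 := by
    intro n
    induction n with
    | zero =>
      intro hn
      have h1 : ‖w 1 - v‖ ≤ D := (norm_sub_le _ _).trans (by linarith [hball 0 hn])
      have h2 : 0 ≤ D ^ 2 - ‖w 1 - v‖ ^ 2 := sub_nonneg.2 (by gcongr)
      simpa using div_nonneg h2 (by positivity : 0 ≤ 2 * η)
    | succ n ih =>
      intro hn
      rw [Finset.sum_Icc_succ_top (by omega), hupd (n + 1) (Finset.mem_Icc.2 (by omega))]
      have h1 := ih (by omega)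
      have h2 := hstep (n + 1) (Finset.mem_Icc.2 (by omega)) (hball n (by omega)) v
      have h3 := div_le_div_of_nonneg_right (norm_ballProj_sub_sq_le hD.le
        (w (n + 1) - η • gradient (f (n + 1)) (w (n + 1))) v hv) (by positivity : 0 ≤ 2 * η)
      simp only [sub_div] at h1 h2 ⊢
      push_cast
      linarith
  have h1 := hpartial N (by omega)
  have h2 := hstep (N + 1) (Finset.mem_Icc.2 (by omega)) (hball N (by omega)) v
  have h3 : 0 ≤ ‖w (N + 1) - η • gradient (f (N + 1)) (w (N + 1)) - v‖ ^ 2 / (2 * η) := by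
    positivity
  have h4 : ∑ t ∈ Finset.Icc 1 (N + 1), (f t (w t) - f t v) ≤
      D ^ 2 / (2 * η) + η * G ^ 2 * (N + 1 : ℕ) / 2 := by
    rw [Finset.sum_Icc_succ_top (by omega)]
    simp only [sub_div] at h1 h2
    push_cast
    linarith
  rw [Finset.sum_sub_distrib] at h4
  linarith
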